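/- (Proposition 2, case 1d) Assume J₁₁ > 0, J₁₂ < 0, set λ_M = J₁₁ − J₁₂, λ_m = J₁₁ + J₁₂, and suppose λ_m > 0. Let β̌ ∈ (0,1) be a solution of β̌·artanh(√(1−β̌))/√(1−β̌) = λ_m/λ_M. If β > 2/(β̌·λ_M), then f has exactly nine critical points in (−1,1)²: the origin (0,0); ±(x̃,−x̃) where x̃ is the unique solution in (0,1) of x = tanh((βλ_M/2)·x); ±(x̂,x̂) where x̂ is the unique solution in (0,1) of x = tanh((βλ_m/2)·x); and four further points ±(x₁*,x₂*), ±(x₂*,x₁*) for some reals x₁* ≠ x₂* in (0,1). The origin is a local minimum point, ±(x̃,−x̃) and ±(x̂,x̂) are local maximum points, and none of the four points ±(x₁*,x₂*), ±(x₂*,x₁*) is a local maximum point of f. -/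

import Mathlib

/-- The entropy function 𝓘(x) = ((1+x)log(1+x) + (1-x)log(1-x))/2.
Note `Real.log 0 = 0` in Mathlib, which implements the convention 0·log 0 = 0. -/
noncomputable def entI (x : ℝ) : ℝ :=
  ((1 + x) * Real.log (1 + x) + (1 - x) * Real.log (1 - x)) / 2

/-- Pressure functional of the symmetric zero-field bipartite mean-field model
(α₁ = α₂ = 1/2, J₁₁ = J₂₂, h₁ = h₂ = 0). -/
noncomputable def fSym (β J11 J12 : ℝ) (μ : ℝ × ℝ) : ℝ :=
  β / 8 * (J11 * (μ.1 ^ 2 + μ.2 ^ 2) + 2 * J12 * μ.1 * μ.2) - (entI μ.1 + entI μ.2) / 2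

/-- A critical point of f: a point of the open square (−1,1)² where both partial
derivatives of f vanish. -/
def IsCritPt (β J11 J12 : ℝ) (μ : ℝ × ℝ) : Prop :=
  μ.1 ∈ Set.Ioo (-1 : ℝ) 1 ∧ μ.2 ∈ Set.Ioo (-1 : ℝ) 1 ∧
    deriv (fun x => fSym β J11 J12 (x, μ.2)) μ.1 = 0 ∧
    deriv (fun y => fSym β J11 J12 (μ.1, y)) μ.2 = 0

/-- The inverse hyperbolic tangent, artanh(x) = (1/2)·log((1+x)/(1−x)). -/
noncomputable def artanh (x : ℝ) : ℝ := (1 / 2) * Real.log ((1 + x) / (1 - x))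

/-- The range of `Real.tanh` lies in `(-1, 1)`. -/
lemma tanh_mem_Ioo (p : ℝ) : Real.tanh p ∈ Set.Ioo (-1 : ℝ) 1 :=
  ⟨Real.neg_one_lt_tanh p, Real.tanh_lt_one p⟩

lemma artanh_tanh_eq (p : ℝ) : artanh (Real.tanh p) = p := by
  have h := tanh_mem_Ioo p
  rw [artanh, ← Real.artanh_eq_half_log ⟨h.1.le, h.2.le⟩, Real.artanh_tanh]

lemma exists_eq_tanh {x : ℝ} (hx : x ∈ Set.Ioo (-1 : ℝ) 1) : ∃ p, x = Real.tanh p :=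
  ⟨Real.artanh x, (Real.tanh_artanh hx).symm⟩

lemma tanh_pos_iff {p : ℝ} : 0 < Real.tanh p ↔ 0 < p := by
  rw [Real.tanh_eq_sinh_div_cosh, div_pos_iff_of_pos_right (Real.cosh_pos p), Real.sinh_pos_iff]

lemma one_sub_tanh_sq (p : ℝ) : 1 - Real.tanh p ^ 2 = 1 / Real.cosh p ^ 2 := by
  have := Real.cosh_pos p
  rw [Real.tanh_eq_sinh_div_cosh]
  field_simp
  rw [Real.cosh_sq]; ring

lemma hasDerivAt_entI {x : ℝ} (hx : x ∈ Set.Ioo (-1 : ℝ) 1) : HasDerivAt entI (artanh x) x := by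
  have h1 : (1 + x) ≠ 0 := by linarith [hx.1]
  have h2 : (1 - x) ≠ 0 := by linarith [hx.2]
  have d1 : HasDerivAt (fun x : ℝ => 1 + x) 1 x := (hasDerivAt_id x).const_add 1
  have d2 : HasDerivAt (fun x : ℝ => 1 - x) (-1) x := (hasDerivAt_id x).const_sub 1
  have := ((d1.mul (d1.log h1)).add (d2.mul (d2.log h2))).div_const 2
  refine this.congr_deriv ?_
  rw [artanh, Real.log_div h1 h2]
  field_simp
  ring

lemma hasDerivAt_artanh {x : ℝ} (hx : x ∈ Set.Ioo (-1 : ℝ) 1) :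
    HasDerivAt artanh (1 / (1 - x ^ 2)) x := by
  have h1 : (1 + x) ≠ 0 := by linarith [hx.1]
  have h2 : (1 - x) ≠ 0 := by linarith [hx.2]
  have d1 : HasDerivAt (fun x : ℝ => 1 + x) 1 x := (hasDerivAt_id x).const_add 1
  have d2 : HasDerivAt (fun x : ℝ => 1 - x) (-1) x := (hasDerivAt_id x).const_sub 1
  have := ((d1.div d2 h2).log (div_ne_zero h1 h2)).const_mul (1 / 2)
  refine this.congr_deriv ?_
  have h3 : 1 - x ^ 2 ≠ 0 := by
    have : 1 - x ^ 2 = (1 + x) * (1 - x) := by ring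
    rw [this]; exact mul_ne_zero h1 h2
  have h4 : 1 - x ^ 2 = (1 + x) * (1 - x) := by ring
  simp only [Pi.div_apply]
  rw [h4]
  field_simp
  ring

/-! ### Monotonicity of `sinh t / t` and `t coth t` -/

lemma sinh_lt_mul_cosh {t : ℝ} (ht : 0 < t) : Real.sinh t < t * Real.cosh t := by
  have h : StrictMonoOn (fun t => t * Real.cosh t - Real.sinh t) (Set.Ici 0) := by
    refine strictMonoOn_of_deriv_pos (convex_Ici 0) (by fun_prop) fun x hx => ?_
    rw [interior_Ici] at hx
    have d : HasDerivAt (fun t => t * Real.cosh t - Real.sinh t)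
        (1 * Real.cosh x + x * Real.sinh x - Real.cosh x) x :=
      ((hasDerivAt_id x).mul (Real.hasDerivAt_cosh x)).sub (Real.hasDerivAt_sinh x)
    rw [d.deriv]
    have := mul_pos (Set.mem_Ioi.1 hx) (Real.sinh_pos_iff.2 hx)
    linarith
  have := h (Set.mem_Ici.2 le_rfl) (Set.mem_Ici.2 ht.le) ht
  simp at this
  linarith

lemma strictMonoOn_sinh_div :
    StrictMonoOn (fun t : ℝ => Real.sinh t / t) (Set.Ioi 0) := by
  refine strictMonoOn_of_deriv_pos (convex_Ioi 0) ?_ fun x hx => ?_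
  · exact Real.continuous_sinh.continuousOn.div continuousOn_id fun x hx => ne_of_gt hx
  rw [interior_Ioi] at hx
  have hx' : 0 < x := hx
  have d : HasDerivAt (fun t => Real.sinh t / t) ((Real.cosh x * x - Real.sinh x * 1) / x ^ 2) x :=
    (Real.hasDerivAt_sinh x).div (hasDerivAt_id x) hx'.ne'
  rw [d.deriv]
  have := sinh_lt_mul_cosh hx'
  apply div_pos _ (by positivity)
  linarith

lemma strictMonoOn_mul_coth :
    StrictMonoOn (fun t : ℝ => t * Real.cosh t / Real.sinh t) (Set.Ioi 0) := by
  have hs : ∀ x ∈ Set.Ioi (0 : ℝ), Real.sinh x ≠ 0 := fun x hx => (Real.sinh_pos_iff.2 hx).ne'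
  refine strictMonoOn_of_deriv_pos (convex_Ioi 0) ?_ fun x hx => ?_
  · exact ContinuousOn.div (by fun_prop) (by fun_prop) hs
  rw [interior_Ioi] at hx
  have hx' : 0 < x := hx
  have d : HasDerivAt (fun t => t * Real.cosh t / Real.sinh t)
      (((1 * Real.cosh x + x * Real.sinh x) * Real.sinh x - x * Real.cosh x * Real.cosh x)
        / Real.sinh x ^ 2) x :=
    ((hasDerivAt_id x).mul (Real.hasDerivAt_cosh x)).div (Real.hasDerivAt_sinh x) (hs x hx)
  rw [d.deriv]
  have h1 := Real.self_lt_sinh_iff.2 hx'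
  have h2 := Real.one_le_cosh x
  have h3 := Real.cosh_sq x
  have h4 : 0 < Real.sinh x := Real.sinh_pos_iff.2 hx'
  apply div_pos _ (by positivity)
  nlinarith

lemma exists_pos_of_hasDerivAt_pos {f : ℝ → ℝ} {d u v : ℝ} (hf : HasDerivAt f d u)
    (hd : 0 < d) (hu : f u = 0) (huv : u < v) : ∃ x ∈ Set.Ioo u v, 0 < f x := by
  have h1 : ∀ᶠ x in nhdsWithin u (Set.Ioi u), 0 < slope f u x :=
    ((hasDerivAt_iff_tendsto_slope.1 hf).mono_left
      (nhdsWithin_mono _ fun x hx => ne_of_gt hx)).eventually (lt_mem_nhds hd)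
  obtain ⟨x, hx, hxuv⟩ := (h1.and (Ioo_mem_nhdsGT huv)).exists
  refine ⟨x, hxuv, ?_⟩
  rw [slope_def_field, hu, sub_zero, div_pos_iff_of_pos_right (sub_pos.2 hxuv.1)] at hx
  exact hx

/-- For `c > 1` the equation `p = c tanh p` has a positive solution. -/
lemma exists_pos_eq_mul_tanh {c : ℝ} (hc : 1 < c) : ∃ p, 0 < p ∧ p = c * Real.tanh p := by
  have hd : HasDerivAt (fun p => c * Real.sinh p - p * Real.cosh p)
      (c * Real.cosh 0 - (1 * Real.cosh 0 + 0 * Real.sinh 0)) 0 :=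
    ((Real.hasDerivAt_sinh 0).const_mul c).sub ((hasDerivAt_id 0).mul (Real.hasDerivAt_cosh 0))
  obtain ⟨e, he, hpos⟩ := exists_pos_of_hasDerivAt_pos hd (by simpa using hc) (by simp)
    (show (0 : ℝ) < c by linarith)
  have hneg : c * Real.sinh c - c * Real.cosh c < 0 := by
    have := Real.sinh_lt_cosh c
    nlinarith
  obtain ⟨p, hp, hp0⟩ := intermediate_value_Icc' he.2.le
    (f := fun p => c * Real.sinh p - p * Real.cosh p) (by fun_prop)
    (show (0 : ℝ) ∈ Set.Icc _ _ from ⟨hneg.le, hpos.le⟩)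
  refine ⟨p, he.1.trans_le hp.1, ?_⟩
  have := Real.cosh_pos p
  rw [Real.tanh_eq_sinh_div_cosh]
  field_simp
  simp only at hp0
  linarith

lemma eq_mul_tanh_iff {c p : ℝ} (hp : 0 < p) :
    p = c * Real.tanh p ↔ p * Real.cosh p / Real.sinh p = c := by
  have h1 := Real.cosh_pos p
  have h2 := Real.sinh_pos_iff.2 hp
  rw [Real.tanh_eq_sinh_div_cosh, div_eq_iff h2.ne', ← mul_div_assoc, eq_div_iff h1.ne']

lemma eq_of_eq_mul_tanh {c p q : ℝ} (hp : 0 < p) (hq : 0 < q) (h1 : p = c * Real.tanh p)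
    (h2 : q = c * Real.tanh q) : p = q := by
  rw [eq_mul_tanh_iff hp] at h1
  rw [eq_mul_tanh_iff hq] at h2
  exact strictMonoOn_mul_coth.injOn hp hq (h1.trans h2.symm)

/-- A nonzero solution of `p = c tanh p` is plus or minus the positive one. -/
lemma eq_or_eq_neg_of_eq_mul_tanh {c p q : ℝ} (hq : 0 < q) (h2 : q = c * Real.tanh q)
    (h1 : p = c * Real.tanh p) : p = 0 ∨ p = q ∨ p = -q := by
  rcases lt_trichotomy p 0 with h | h | h
  · right; right
    have := eq_of_eq_mul_tanh (p := -p) (c := c) (by linarith) hq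
      (by rw [Real.tanh_neg]; linarith) h2
    linarith
  · exact Or.inl h
  · exact Or.inr (Or.inl (eq_of_eq_mul_tanh h hq h1 h2))

/-! ### The critical point equations in rotated hyperbolic coordinates -/

lemma cosh_add_cosh_eq (p q : ℝ) :
    Real.cosh (p + q) + Real.cosh (p - q) = 2 * (Real.cosh p * Real.cosh q) := by
  rw [Real.cosh_add, Real.cosh_sub]; ring

/-- The critical point equations in terms of `S = p + q` and `D = p - q`. -/
lemma tanh_system_iff {a b p q : ℝ} :
    (p = a * Real.tanh p - b * Real.tanh q ∧ q = a * Real.tanh q - b * Real.tanh p) ↔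
    ((p + q) * (Real.cosh (p + q) + Real.cosh (p - q)) = 2 * (a - b) * Real.sinh (p + q) ∧
      (p - q) * (Real.cosh (p + q) + Real.cosh (p - q)) = 2 * (a + b) * Real.sinh (p - q)) := by
  rw [cosh_add_cosh_eq]
  have h1 := Real.cosh_pos p
  have h2 := Real.cosh_pos q
  have e1 : Real.sinh (p + q) = (Real.tanh p + Real.tanh q) * (Real.cosh p * Real.cosh q) := by
    rw [Real.tanh_eq_sinh_div_cosh, Real.tanh_eq_sinh_div_cosh, Real.sinh_add]
    field_simp
  have e2 : Real.sinh (p - q) = (Real.tanh p - Real.tanh q) * (Real.cosh p * Real.cosh q) := by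
    rw [Real.tanh_eq_sinh_div_cosh, Real.tanh_eq_sinh_div_cosh, Real.sinh_sub]
    field_simp
  have hK : Real.cosh p * Real.cosh q ≠ 0 := (mul_pos h1 h2).ne'
  rw [e1, e2]
  constructor
  · rintro ⟨h, h'⟩
    constructor
    · linear_combination 2 * (Real.cosh p * Real.cosh q) * (h + h')
    · linear_combination 2 * (Real.cosh p * Real.cosh q) * (h - h')
  · rintro ⟨h, h'⟩
    have g1 : p + q = (a - b) * (Real.tanh p + Real.tanh q) :=
      mul_right_cancel₀ hK (by linarith)
    have g2 : p - q = (a + b) * (Real.tanh p - Real.tanh q) :=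
      mul_right_cancel₀ hK (by linarith)
    constructor
    · linear_combination (g1 + g2) / 2
    · linear_combination (g1 - g2) / 2

/-- Uniqueness of the positive solution of the rotated system. -/
lemma rotated_unique {m M S D S' D' : ℝ} (hm : 0 < m) (hM : 0 < M)
    (hS : 0 < S) (hD : 0 < D) (hS' : 0 < S') (hD' : 0 < D')
    (h1 : S * (Real.cosh S + Real.cosh D) = 2 * m * Real.sinh S)
    (h2 : D * (Real.cosh S + Real.cosh D) = 2 * M * Real.sinh D)
    (h1' : S' * (Real.cosh S' + Real.cosh D') = 2 * m * Real.sinh S')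
    (h2' : D' * (Real.cosh S' + Real.cosh D') = 2 * M * Real.sinh D') : S = S' ∧ D = D' := by
  have ratio : ∀ S D : ℝ, 0 < S → 0 < D →
      S * (Real.cosh S + Real.cosh D) = 2 * m * Real.sinh S →
      D * (Real.cosh S + Real.cosh D) = 2 * M * Real.sinh D →
      m * (Real.sinh S / S) = M * (Real.sinh D / D) := by
    intro S D hS hD h1 h2
    field_simp
    linear_combination (S * h2 - D * h1) / 2
  have total : ∀ S D : ℝ, 0 < S → 0 < D →
      S * (Real.cosh S + Real.cosh D) = 2 * m * Real.sinh S →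
      D * (Real.cosh S + Real.cosh D) = 2 * M * Real.sinh D →
      M * (S * Real.cosh S / Real.sinh S) + m * (D * Real.cosh D / Real.sinh D) = 2 * m * M := by
    intro S D hS hD h1 h2
    have hs := Real.sinh_pos_iff.2 hS
    have hd := Real.sinh_pos_iff.2 hD
    have hK : 0 < Real.cosh S + Real.cosh D := add_pos (Real.cosh_pos S) (Real.cosh_pos D)
    have g1 : S / Real.sinh S = 2 * m / (Real.cosh S + Real.cosh D) := by
      rw [div_eq_div_iff hs.ne' hK.ne']; exact h1
    have g2 : D / Real.sinh D = 2 * M / (Real.cosh S + Real.cosh D) := by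
      rw [div_eq_div_iff hd.ne' hK.ne']; exact h2
    rw [mul_div_right_comm, mul_div_right_comm, g1, g2]
    field_simp
  have key : ∀ S D S' D' : ℝ, 0 < S → 0 < D → 0 < S' → 0 < D' →
      m * (Real.sinh S / S) = M * (Real.sinh D / D) →
      m * (Real.sinh S' / S') = M * (Real.sinh D' / D') →
      M * (S * Real.cosh S / Real.sinh S) + m * (D * Real.cosh D / Real.sinh D) = 2 * m * M →
      M * (S' * Real.cosh S' / Real.sinh S') + m * (D' * Real.cosh D' / Real.sinh D')
        = 2 * m * M → ¬ D < D' := by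
    intro S D S' D' hS hD hS' hD' r r' t t' hlt
    have a1 : Real.sinh D / D < Real.sinh D' / D' := strictMonoOn_sinh_div hD hD' hlt
    have a2 : Real.sinh S / S < Real.sinh S' / S' := by
      have := mul_lt_mul_of_pos_left a1 hM
      rw [← r, ← r'] at this
      exact lt_of_mul_lt_mul_left this hm.le
    have a3 : S < S' := (strictMonoOn_sinh_div.lt_iff_lt hS hS').1 a2
    have b1 : D * Real.cosh D / Real.sinh D < D' * Real.cosh D' / Real.sinh D' :=
      strictMonoOn_mul_coth hD hD' hlt
    have b2 : S * Real.cosh S / Real.sinh S < S' * Real.cosh S' / Real.sinh S' :=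
      strictMonoOn_mul_coth hS hS' a3
    have := mul_lt_mul_of_pos_left b1 hm
    have := mul_lt_mul_of_pos_left b2 hM
    linarith
  have r := ratio S D hS hD h1 h2
  have r' := ratio S' D' hS' hD' h1' h2'
  have t := total S D hS hD h1 h2
  have t' := total S' D' hS' hD' h1' h2'
  have hDD : D = D' := le_antisymm
    (not_lt.1 (key S' D' S D hS' hD' hS hD r' r t' t))
    (not_lt.1 (key S D S' D' hS hD hS' hD' r r' t t'))
  subst hDD
  have hSS := mul_left_cancel₀ hm.ne' (r.trans r'.symm)
  exact ⟨strictMonoOn_sinh_div.injOn hS hS' hSS, rfl⟩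

/-! ### Second order conditions for the pressure functional -/

lemma fSym_eq (β J11 J12 : ℝ) : fSym β J11 J12 = fSym 2 (β * J11 / 2) (β * J12 / 2) := by
  funext μ
  simp only [fSym]
  ring

lemma isCritPt_eq (β J11 J12 : ℝ) (μ : ℝ × ℝ) :
    IsCritPt β J11 J12 μ ↔ IsCritPt 2 (β * J11 / 2) (β * J12 / 2) μ := by
  rw [IsCritPt, IsCritPt, fSym_eq]

lemma isCritPt_iff {a b x y : ℝ} : IsCritPt 2 a (-b) (x, y) ↔
    x ∈ Set.Ioo (-1 : ℝ) 1 ∧ y ∈ Set.Ioo (-1 : ℝ) 1 ∧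
      artanh x = a * x - b * y ∧ artanh y = a * y - b * x := by
  refine and_congr_right fun hx => and_congr_right fun hy => ?_
  have d1 : HasDerivAt (fun x => fSym 2 a (-b) (x, y)) ((a * x - b * y - artanh x) / 2) x := by
    have h1 : HasDerivAt (fun x : ℝ => x ^ 2 + y ^ 2) (2 * x) x := by
      simpa using (hasDerivAt_pow 2 x).add_const (y ^ 2)
    have h2 : HasDerivAt (fun x : ℝ => 2 * -b * x * y) (2 * -b * 1 * y) x :=
      ((hasDerivAt_id x).const_mul (2 * -b)).mul_const y
    have h3 := (((h1.const_mul a).add h2).const_mul (2 / 8)).sub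
      (((hasDerivAt_entI hx).add_const (entI y)).div_const 2)
    refine h3.congr_deriv ?_
    ring
  have d2 : HasDerivAt (fun y => fSym 2 a (-b) (x, y)) ((a * y - b * x - artanh y) / 2) y := by
    have h1 : HasDerivAt (fun y : ℝ => x ^ 2 + y ^ 2) (2 * y) y := by
      simpa using (hasDerivAt_pow 2 y).const_add (x ^ 2)
    have h2 : HasDerivAt (fun y : ℝ => 2 * -b * x * y) (2 * -b * x * 1) y :=
      (hasDerivAt_id y).const_mul (2 * -b * x)
    have h3 := (((h1.const_mul a).add h2).const_mul (2 / 8)).sub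
      (((hasDerivAt_entI hy).const_add (entI x)).div_const 2)
    refine h3.congr_deriv ?_
    ring
  simp only
  rw [d1.deriv, d2.deriv]
  constructor <;> rintro ⟨h, h'⟩ <;> constructor <;> linarith

lemma isCritPt_tanh_iff {a b p q : ℝ} : IsCritPt 2 a (-b) (Real.tanh p, Real.tanh q) ↔
    (p = a * Real.tanh p - b * Real.tanh q ∧ q = a * Real.tanh q - b * Real.tanh p) := by
  rw [isCritPt_iff, artanh_tanh_eq, artanh_tanh_eq]
  exact ⟨fun h => h.2.2, fun h => ⟨tanh_mem_Ioo p, tanh_mem_Ioo q, h⟩⟩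

/-- The second derivative test in terms of an explicit derivative near the point. -/
lemma isLocalMin_of_hasDerivAt_hasDerivAt {f f' : ℝ → ℝ} {d t : ℝ}
    (h : ∀ᶠ s in nhds t, HasDerivAt f (f' s) s) (h0 : f' t = 0) (h' : HasDerivAt f' d t)
    (hd : 0 < d) : IsLocalMin f t := by
  have e : deriv f =ᶠ[nhds t] f' := h.mono fun s hs => hs.deriv
  refine isLocalMin_of_deriv_deriv_pos ?_ ?_ h.self_of_nhds.continuousAt
  · rw [e.deriv_eq, h'.deriv]; exact hd
  · rw [h.self_of_nhds.deriv, h0]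

/-- Near `x`, the entropy lies above a parabola of curvature `c < 1 / (1 - x²)`. -/
lemma entI_ge_parabola {x c : ℝ} (hx : x ∈ Set.Ioo (-1 : ℝ) 1) (hc : c < 1 / (1 - x ^ 2)) :
    ∀ᶠ z in nhds x, entI x + artanh x * (z - x) + c / 2 * (z - x) ^ 2 ≤ entI z := by
  have hd : ∀ z ∈ Set.Ioo (-1 : ℝ) 1,
      HasDerivAt (fun z => entI z - artanh x * (z - x) - c / 2 * (z - x) ^ 2)
        (artanh z - artanh x - c * (z - x)) z := fun z hz => by
    have h1 : HasDerivAt (fun z => z - x) 1 z := (hasDerivAt_id z).sub_const x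
    refine (((hasDerivAt_entI hz).sub (h1.const_mul (artanh x))).sub
      ((h1.pow 2).const_mul (c / 2))).congr_deriv ?_
    simp
    ring
  have hd' : HasDerivAt (fun z => artanh z - artanh x - c * (z - x)) (1 / (1 - x ^ 2) - c * 1) x :=
    ((hasDerivAt_artanh hx).sub_const _).sub (((hasDerivAt_id x).sub_const x).const_mul c)
  have := isLocalMin_of_hasDerivAt_hasDerivAt
    (Filter.mem_of_superset (isOpen_Ioo.mem_nhds hx) hd) (by simp) hd' (by linarith)
  filter_upwards [this] with z hz
  simp at hz
  linarith

/-- Near `x`, the entropy lies below a parabola of curvature `c > 1 / (1 - x²)`. -/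
lemma entI_le_parabola {x c : ℝ} (hx : x ∈ Set.Ioo (-1 : ℝ) 1) (hc : 1 / (1 - x ^ 2) < c) :
    ∀ᶠ z in nhds x, entI z ≤ entI x + artanh x * (z - x) + c / 2 * (z - x) ^ 2 := by
  have hd : ∀ z ∈ Set.Ioo (-1 : ℝ) 1,
      HasDerivAt (fun z => artanh x * (z - x) + c / 2 * (z - x) ^ 2 - entI z)
        (artanh x + c * (z - x) - artanh z) z := fun z hz => by
    have h1 : HasDerivAt (fun z => z - x) 1 z := (hasDerivAt_id z).sub_const x
    refine (((h1.const_mul (artanh x)).add ((h1.pow 2).const_mul (c / 2))).sub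
      (hasDerivAt_entI hz)).congr_deriv ?_
    simp
    ring
  have hd' : HasDerivAt (fun z => artanh x + c * (z - x) - artanh z) (c * 1 - 1 / (1 - x ^ 2)) x :=
    ((((hasDerivAt_id x).sub_const x).const_mul c).const_add _).sub (hasDerivAt_artanh hx)
  have := isLocalMin_of_hasDerivAt_hasDerivAt
    (Filter.mem_of_superset (isOpen_Ioo.mem_nhds hx) hd) (by simp) hd' (by linarith)
  filter_upwards [this] with z hz
  simp at hz
  linarith

lemma isLocalMax_fSym {a b x y : ℝ} (hb : 0 < b) (hc : IsCritPt 2 a (-b) (x, y))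
    (hx : a + b < 1 / (1 - x ^ 2)) (hy : a + b < 1 / (1 - y ^ 2)) :
    IsLocalMax (fSym 2 a (-b)) (x, y) := by
  obtain ⟨hx1, hy1, e1, e2⟩ := isCritPt_iff.1 hc
  have h1 := (continuous_fst.tendsto (x, y)).eventually (entI_ge_parabola hx1 hx)
  have h2 := (continuous_snd.tendsto (x, y)).eventually (entI_ge_parabola hy1 hy)
  filter_upwards [h1, h2] with ⟨z, w⟩ hz hw
  simp only [fSym] at hz hw ⊢
  rw [e1] at hz
  rw [e2] at hw
  nlinarith [mul_nonneg hb.le (sq_nonneg ((z - x) + (w - y)))]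

lemma isLocalMin_fSym_zero {a b : ℝ} (hb : 0 < b) (hm : 1 < a - b) :
    IsLocalMin (fSym 2 a (-b)) (0, 0) := by
  have h0 : (0 : ℝ) ∈ Set.Ioo (-1 : ℝ) 1 := by constructor <;> norm_num
  have h := entI_le_parabola (c := a - b) h0 (by simpa using hm)
  have h1 := (continuous_fst.tendsto ((0 : ℝ), (0 : ℝ))).eventually h
  have h2 := (continuous_snd.tendsto ((0 : ℝ), (0 : ℝ))).eventually h
  have ha : artanh 0 = 0 := by simp [artanh]
  filter_upwards [h1, h2] with ⟨z, w⟩ hz hw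
  simp only [fSym, ha] at hz hw ⊢
  nlinarith [mul_nonneg hb.le (sq_nonneg (z - w))]

/-- A direction of positive curvature rules out a local maximum. -/
lemma not_isLocalMax_of_direction {a b x y u v : ℝ} (hc : IsCritPt 2 a (-b) (x, y))
    (hq : 0 < (a - 1 / (1 - x ^ 2)) * u ^ 2 - 2 * b * u * v + (a - 1 / (1 - y ^ 2)) * v ^ 2) :
    ¬ IsLocalMax (fSym 2 a (-b)) (x, y) := by
  obtain ⟨hx, hy, e1, e2⟩ := isCritPt_iff.1 hc
  intro hmax
  set Q := (a - 1 / (1 - x ^ 2)) * u ^ 2 - 2 * b * u * v + (a - 1 / (1 - y ^ 2)) * v ^ 2 with hQ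
  have lx : ∀ t, HasDerivAt (fun t => x + t * u) u t := fun t => by
    simpa using ((hasDerivAt_id t).mul_const u).const_add x
  have ly : ∀ t, HasDerivAt (fun t => y + t * v) v t := fun t => by
    simpa using ((hasDerivAt_id t).mul_const v).const_add y
  have cx : Filter.Tendsto (fun t => x + t * u) (nhds 0) (nhds x) := by
    simpa using (lx 0).continuousAt.tendsto
  have cy : Filter.Tendsto (fun t => y + t * v) (nhds 0) (nhds y) := by
    simpa using (ly 0).continuousAt.tendsto
  let g : ℝ → ℝ := fun t => fSym 2 a (-b) (x + t * u, y + t * v) - Q / 8 * t ^ 2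
  let g' : ℝ → ℝ := fun t =>
    (u * (a * (x + t * u) - b * (y + t * v) - artanh (x + t * u))
      + v * (a * (y + t * v) - b * (x + t * u) - artanh (y + t * v))) / 2 - Q / 4 * t
  have hg : ∀ᶠ t in nhds 0, HasDerivAt g (g' t) t := by
    filter_upwards [cx.eventually (isOpen_Ioo.mem_nhds hx), cy.eventually (isOpen_Ioo.mem_nhds hy)]
      with t htx hty
    have i1 := (hasDerivAt_entI htx).comp t (lx t)
    have i2 := (hasDerivAt_entI hty).comp t (ly t)
    have i3 := (((lx t).pow 2).add ((ly t).pow 2)).const_mul a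
    have i4 := ((lx t).const_mul (2 * -b)).mul (ly t)
    refine ((((i3.add i4).const_mul (2 / 8)).sub ((i1.add i2).div_const 2)).sub
      ((hasDerivAt_pow 2 t).const_mul (Q / 8))).congr_deriv ?_
    simp only [g']
    simp
    ring
  have hg' : HasDerivAt g' (Q / 4) 0 := by
    have j1 : HasDerivAt (fun t => artanh (x + t * u)) (1 / (1 - x ^ 2) * u) 0 :=
      HasDerivAt.comp (h₂ := artanh) (0 : ℝ) (by rw [zero_mul, add_zero]; exact hasDerivAt_artanh hx)
        (lx 0)
    have j2 : HasDerivAt (fun t => artanh (y + t * v)) (1 / (1 - y ^ 2) * v) 0 :=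
      HasDerivAt.comp (h₂ := artanh) (0 : ℝ) (by rw [zero_mul, add_zero]; exact hasDerivAt_artanh hy)
        (ly 0)
    have j3 := (((((lx 0).const_mul a).sub ((ly 0).const_mul b)).sub j1).const_mul u).add
      (((((ly 0).const_mul a).sub ((lx 0).const_mul b)).sub j2).const_mul v)
    refine ((j3.div_const 2).sub ((hasDerivAt_id (0 : ℝ)).const_mul (Q / 4))).congr_deriv ?_
    rw [hQ]
    ring
  have hmin : IsLocalMin g 0 :=
    isLocalMin_of_hasDerivAt_hasDerivAt hg (by simp [g', e1, e2]) hg' (by linarith)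
  have hmax' : ∀ᶠ t in nhds (0 : ℝ), fSym 2 a (-b) (x + t * u, y + t * v) ≤ fSym 2 a (-b) (x, y) :=
    (cx.prodMk_nhds cy).eventually hmax
  have hboth : ∀ᶠ t in nhdsWithin (0 : ℝ) (Set.Ioi 0), False := by
    filter_upwards [nhdsWithin_le_nhds hmin, nhdsWithin_le_nhds hmax', self_mem_nhdsWithin]
      with t ht1 ht2 ht3
    have ht3 : 0 < t := ht3
    simp [g] at ht1
    nlinarith [pow_pos ht3 2]
  exact hboth.exists.elim fun _ h => h

/-- A critical point whose Hessian has negative determinant is not a local maximum. -/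
lemma not_isLocalMax_of_det_neg {a b x y : ℝ} (hb : 0 < b) (hc : IsCritPt 2 a (-b) (x, y))
    (hdet : (1 / (1 - x ^ 2) - a) * (1 / (1 - y ^ 2) - a) < b ^ 2) :
    ¬ IsLocalMax (fSym 2 a (-b)) (x, y) := by
  set P := a - 1 / (1 - x ^ 2) with hP
  set R := a - 1 / (1 - y ^ 2) with hR
  have hPR : P * R < b ^ 2 := by
    have : P * R = (1 / (1 - x ^ 2) - a) * (1 / (1 - y ^ 2) - a) := by rw [hP, hR]; ring
    linarith
  rcases lt_trichotomy P 0 with h | h | h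
  · refine not_isLocalMax_of_direction (u := b) (v := P) hc ?_
    rw [← hP, ← hR]
    nlinarith [mul_pos (neg_pos.2 h) (sub_pos.2 hPR)]
  · refine not_isLocalMax_of_direction (u := (R - 1) / (2 * b)) (v := 1) hc ?_
    rw [← hP, ← hR, h]
    field_simp
    linarith [pow_pos hb 2]
  · refine not_isLocalMax_of_direction (u := 1) (v := 0) hc ?_
    rw [← hP, ← hR]
    simpa using h

/-! ### The mixed critical points -/

lemma tanh_lt_tanh_iff {p q : ℝ} : Real.tanh p < Real.tanh q ↔ p < q := by
  rw [← Real.artanh_lt_artanh_iff (tanh_mem_Ioo p) (tanh_mem_Ioo q), Real.artanh_tanh,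
    Real.artanh_tanh]

lemma det_neg_of_rotated {a b p q : ℝ} (hq : 0 < q) (hqp : q < p)
    (h1 : (p + q) * (Real.cosh (p + q) + Real.cosh (p - q)) = 2 * (a - b) * Real.sinh (p + q))
    (h2 : (p - q) * (Real.cosh (p + q) + Real.cosh (p - q)) = 2 * (a + b) * Real.sinh (p - q)) :
    (Real.cosh p ^ 2 - a) * (Real.cosh q ^ 2 - a) < b ^ 2 := by
  have hS : 0 < p + q := by linarith
  have hD : 0 < p - q := by linarith
  have hprod : Real.cosh p ^ 2 * Real.cosh q ^ 2
      = (Real.cosh (p + q) + Real.cosh (p - q)) ^ 2 / 4 := by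
    rw [cosh_add_cosh_eq]; ring
  have hsum : Real.cosh p ^ 2 + Real.cosh q ^ 2
      = 1 + Real.cosh (p + q) * Real.cosh (p - q) := by
    rw [Real.cosh_add, Real.cosh_sub]
    linear_combination (-Real.cosh q ^ 2) * Real.cosh_sq p
      - (Real.sinh p ^ 2) * Real.cosh_sq q + Real.cosh_sq p
  generalize p + q = S at *
  generalize p - q = D at *
  have hs := Real.sinh_pos_iff.2 hS
  have hd := Real.sinh_pos_iff.2 hD
  have hC : 1 < Real.cosh S := Real.one_lt_cosh.2 hS.ne'
  have hc : 1 < Real.cosh D := Real.one_lt_cosh.2 hD.ne'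
  obtain ⟨s, hs'⟩ : ∃ s, s = S / Real.sinh S := ⟨_, rfl⟩
  obtain ⟨d, hd'⟩ : ∃ d, d = D / Real.sinh D := ⟨_, rfl⟩
  have s1 : s < 1 := by rw [hs', div_lt_one hs]; exact Real.self_lt_sinh_iff.2 hS
  have d1 : d < 1 := by rw [hd', div_lt_one hd]; exact Real.self_lt_sinh_iff.2 hD
  have hX : 1 < Real.cosh S * s := by
    rw [hs', ← mul_div_assoc, one_lt_div hs]
    linarith [sinh_lt_mul_cosh hS]
  have hY : 1 < Real.cosh D * d := by
    rw [hd', ← mul_div_assoc, one_lt_div hd]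
    linarith [sinh_lt_mul_cosh hD]
  have hm : (Real.cosh S + Real.cosh D) * s = 2 * (a - b) := by
    rw [hs', ← mul_div_assoc, div_eq_iff hs.ne']; linarith
  have hM : (Real.cosh S + Real.cosh D) * d = 2 * (a + b) := by
    rw [hd', ← mul_div_assoc, div_eq_iff hd.ne']; linarith
  generalize Real.cosh S = C at *
  generalize Real.cosh D = c at *
  have key : 0 < (C * s - 1) * (c - d) + (c * d - 1) * (C - s) := by
    have := mul_pos (sub_pos.2 hX) (sub_pos.2 (d1.trans hc))
    have := mul_pos (sub_pos.2 hY) (sub_pos.2 (s1.trans hC))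
    linarith
  have key' := mul_pos (show 0 < (C + c) / 4 by linarith) key
  have ea : a = (C + c) * (s + d) / 4 := by linear_combination -(hm + hM) / 4
  have eb : b = (C + c) * (d - s) / 4 := by linear_combination -(hM - hm) / 4
  have : (Real.cosh p ^ 2 - a) * (Real.cosh q ^ 2 - a) - b ^ 2
      = -((C + c) / 4 * ((C * s - 1) * (c - d) + (c * d - 1) * (C - s))) := by
    have : (Real.cosh p ^ 2 - a) * (Real.cosh q ^ 2 - a) - b ^ 2
      = Real.cosh p ^ 2 * Real.cosh q ^ 2 - a * (Real.cosh p ^ 2 + Real.cosh q ^ 2)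
        + a ^ 2 - b ^ 2 := by ring
    rw [this, hprod, hsum, ea, eb]
    ring
  linarith

/-- Past the bifurcation value, the diagonal critical point is stable. -/
lemma lt_cosh_sq_of_bifurcation {m M p₀ p : ℝ} (hm : 0 < m) (hp₀ : 0 < p₀) (hp : 0 < p)
    (h : M * p₀ = m * (Real.sinh p₀ * Real.cosh p₀)) (hM : Real.cosh p₀ ^ 2 < M)
    (hpm : p = m * Real.tanh p) : M < Real.cosh p ^ 2 := by
  have hs₀ := Real.sinh_pos_iff.2 hp₀
  have hs := Real.sinh_pos_iff.2 hp
  have hc₀ := Real.cosh_pos p₀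
  have hc := Real.cosh_pos p
  rw [eq_mul_tanh_iff hp] at hpm
  have h1 : p₀ * Real.cosh p₀ / Real.sinh p₀ < p * Real.cosh p / Real.sinh p := by
    rw [hpm, div_lt_iff₀ hs₀]
    refine lt_of_mul_lt_mul_right ?_ hc₀.le
    nlinarith
  have h2 : p₀ < p := (strictMonoOn_mul_coth.lt_iff_lt hp₀ hp).1 h1
  have h3 : Real.sinh (2 * p₀) / (2 * p₀) < Real.sinh (2 * p) / (2 * p) :=
    strictMonoOn_sinh_div (show (0 : ℝ) < 2 * p₀ by linarith)
      (show (0 : ℝ) < 2 * p by linarith) (by linarith)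
  rw [Real.sinh_two_mul, Real.sinh_two_mul, mul_assoc, mul_assoc,
    mul_div_mul_left _ _ two_ne_zero, mul_div_mul_left _ _ two_ne_zero] at h3
  have h4 : M = m * (Real.sinh p₀ * Real.cosh p₀ / p₀) := by
    rw [← mul_div_assoc, ← h]; field_simp
  have h5 : Real.cosh p ^ 2 = m * (Real.sinh p * Real.cosh p / p) := by
    rw [← hpm]; field_simp
  rw [h4, h5]
  exact mul_lt_mul_of_pos_left h3 hm

/-- If the diagonal critical point is stable there is a critical point with `0 < y < x`. -/
lemma exists_mixed {a b ph : ℝ} (hb : 0 < b) (hm : 1 < a - b) (hph : 0 < ph)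
    (he : ph = (a - b) * Real.tanh ph) (hst : a + b < Real.cosh ph ^ 2) :
    ∃ p q, 0 < q ∧ q < p ∧
      p = a * Real.tanh p - b * Real.tanh q ∧ q = a * Real.tanh q - b * Real.tanh p := by
  obtain ⟨pa, hpa, hea⟩ := exists_pos_eq_mul_tanh (show 1 < a by linarith)
  have hlt : ph < pa := by
    refine (strictMonoOn_mul_coth.lt_iff_lt hph hpa).1 ?_
    rw [(eq_mul_tanh_iff hph).1 he, (eq_mul_tanh_iff hpa).1 hea]
    linarith
  set xh := Real.tanh ph with hxh
  set xa := Real.tanh pa with hxa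
  have hxlt : xh < xa := tanh_lt_tanh_iff.2 hlt
  have hxh0 : 0 < xh := tanh_pos_iff.2 hph
  have hxa1 : xa < 1 := Real.tanh_lt_one pa
  have hxhI : xh ∈ Set.Ioo (-1 : ℝ) 1 := tanh_mem_Ioo ph
  let g : ℝ → ℝ := fun x => (a * x - artanh x) / b
  have hg : ∀ x ∈ Set.Ioo (-1 : ℝ) 1, HasDerivAt g ((a - 1 / (1 - x ^ 2)) / b) x := fun x hx => by
    refine ((((hasDerivAt_id x).const_mul a).sub (hasDerivAt_artanh hx)).div_const b).congr_deriv ?_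
    ring
  have hgh : g xh = xh := by
    simp only [g]
    rw [hxh, artanh_tanh_eq, ← hxh, div_eq_iff hb.ne']
    linear_combination -he
  have hga : g xa = 0 := by
    simp only [g]
    rw [hxa, artanh_tanh_eq, ← hxa, div_eq_iff hb.ne']
    linear_combination -hea
  have hg0 : g 0 = 0 := by simp [g, artanh]
  have hh : a + b < 1 / (1 - xh ^ 2) := by
    rw [hxh, one_sub_tanh_sq, one_div_one_div]; exact hst
  have hsub : Set.Icc xh xa ⊆ Set.Ioo (-1 : ℝ) 1 := fun x hx =>
    ⟨by linarith [hx.1], hx.2.trans_lt hxa1⟩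
  have hcont : ContinuousOn g (Set.Ioo (-1 : ℝ) 1) := fun x hx =>
    (hg x hx).continuousAt.continuousWithinAt
  have hanti : StrictAntiOn g (Set.Icc xh xa) := by
    refine strictAntiOn_of_deriv_neg (convex_Icc _ _) (hcont.mono hsub) fun x hx => ?_
    rw [interior_Icc] at hx
    have hxI := hsub (Set.Ioo_subset_Icc_self hx)
    rw [(hg x hxI).deriv]
    have : 1 / (1 - xh ^ 2) ≤ 1 / (1 - x ^ 2) := by
      apply one_div_le_one_div_of_le
      · nlinarith [hxI.1, hxI.2]
      · nlinarith [hx.1]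
    exact div_neg_of_neg_of_pos (by linarith) hb
  have hmaps : Set.MapsTo g (Set.Icc xh xa) (Set.Ioo (-1 : ℝ) 1) := fun x hx => by
    have h1 := hanti.antitoneOn (Set.left_mem_Icc.2 hxlt.le) hx hx.1
    have h2 := hanti.antitoneOn hx (Set.right_mem_Icc.2 hxlt.le) hx.2
    rw [hgh] at h1
    rw [hga] at h2
    constructor <;> linarith [hxhI.2]
  have hΓ : HasDerivAt (fun x => g (g x) - x)
      ((a - 1 / (1 - xh ^ 2)) / b * ((a - 1 / (1 - xh ^ 2)) / b) - 1) xh :=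
    (HasDerivAt.comp (h₂ := g) xh (by rw [hgh]; exact hg xh hxhI) (hg xh hxhI)).sub
      (hasDerivAt_id xh)
  have hpos : 0 < (a - 1 / (1 - xh ^ 2)) / b * ((a - 1 / (1 - xh ^ 2)) / b) - 1 := by
    have : (a - 1 / (1 - xh ^ 2)) / b < -1 := by
      rw [div_lt_iff₀ hb]; linarith
    nlinarith
  obtain ⟨c, hc, hcpos⟩ := exists_pos_of_hasDerivAt_pos hΓ hpos (by simp [hgh]) hxlt
  have hcsub : Set.Icc c xa ⊆ Set.Icc xh xa := Set.Icc_subset_Icc_left hc.1.le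
  have hΓc : ContinuousOn (fun x => g (g x) - x) (Set.Icc c xa) :=
    (hcont.comp ((hcont.mono hsub).mono hcsub) (hmaps.mono_left hcsub)).sub continuousOn_id
  obtain ⟨x, hx, hx0⟩ := intermediate_value_Icc' hc.2.le hΓc
    (show (0 : ℝ) ∈ Set.Icc _ _ from ⟨by simp [hga, hg0]; linarith, hcpos.le⟩)
  simp only at hx0
  have hxa' : x < xa := by
    refine lt_of_le_of_ne hx.2 fun h => ?_
    rw [h, hga, hg0] at hx0
    linarith
  have hxh' : xh < x := hc.1.trans_le hx.1
  have hxIcc : x ∈ Set.Icc xh xa := ⟨hxh'.le, hx.2⟩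
  have hy0 : 0 < g x := hga ▸ hanti hxIcc (Set.right_mem_Icc.2 hxlt.le) hxa'
  have hyx : g x < x := (hgh ▸ hanti (Set.left_mem_Icc.2 hxlt.le) hxIcc hxh' : g x < xh).trans hxh'
  obtain ⟨p, hp⟩ := exists_eq_tanh (hsub hxIcc)
  obtain ⟨q, hq⟩ := exists_eq_tanh (hmaps hxIcc)
  refine ⟨p, q, tanh_pos_iff.1 (hq ▸ hy0), tanh_lt_tanh_iff.1 (by rw [← hp, ← hq]; exact hyx),
    ?_, ?_⟩
  · rw [← hq, ← hp]
    simp only [g]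
    rw [mul_div_cancel₀ _ hb.ne', hp, artanh_tanh_eq]
    ring
  · have : b * g (g x) = b * x := by rw [sub_eq_zero.1 hx0]
    rw [hq] at this
    simp only [g] at this
    rw [mul_div_cancel₀ _ hb.ne', artanh_tanh_eq] at this
    rw [← hp]
    linarith

/-- The solutions of the critical point equations in hyperbolic coordinates. -/
lemma tanh_system_cases {a b pt ph p₁ p₂ p q : ℝ} (hb : 0 < b) (hm : 0 < a - b)
    (hpt : 0 < pt) (het : pt = (a + b) * Real.tanh pt)
    (hph : 0 < ph) (heh : ph = (a - b) * Real.tanh ph)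
    (h₂ : 0 < p₂) (h₂₁ : p₂ < p₁)
    (hs₁ : p₁ = a * Real.tanh p₁ - b * Real.tanh p₂) (hs₂ : p₂ = a * Real.tanh p₂ - b * Real.tanh p₁)
    (hp : p = a * Real.tanh p - b * Real.tanh q) (hq : q = a * Real.tanh q - b * Real.tanh p) :
    (p = 0 ∧ q = 0) ∨ (p = pt ∧ q = -pt) ∨ (p = -pt ∧ q = pt) ∨ (p = ph ∧ q = ph) ∨
      (p = -ph ∧ q = -ph) ∨ (p = p₁ ∧ q = p₂) ∨ (p = -p₁ ∧ q = -p₂) ∨ (p = p₂ ∧ q = p₁) ∨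
      (p = -p₂ ∧ q = -p₁) := by
  by_cases hD : p - q = 0
  · have e : q = p := by linarith
    subst e
    rcases eq_or_eq_neg_of_eq_mul_tanh (p := q) hph heh (by linarith) with h | h | h <;> simp [h]
  by_cases hS : p + q = 0
  · have e : q = -p := by linarith
    subst e
    rw [Real.tanh_neg] at hp
    rcases eq_or_eq_neg_of_eq_mul_tanh (p := p) hpt het (by linarith) with h | h | h <;> simp [h]
  obtain ⟨g1, g2⟩ := tanh_system_iff.1 ⟨hp, hq⟩
  obtain ⟨f1, f2⟩ := tanh_system_iff.1 ⟨hs₁, hs₂⟩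
  have habs : ∀ S C c : ℝ, S * C = c * Real.sinh S → |S| * C = c * Real.sinh |S| := by
    intro S C c h
    rcases abs_cases S with ⟨h', _⟩ | ⟨h', _⟩ <;> rw [h']
    · exact h
    · rw [Real.sinh_neg]; linarith
  have g1' := habs _ _ _ g1
  have g2' := habs _ _ _ g2
  rw [← Real.cosh_abs (p + q), ← Real.cosh_abs (p - q)] at g1' g2'
  obtain ⟨r1, r2⟩ := rotated_unique hm (show 0 < a + b by linarith) (abs_pos.2 hS) (abs_pos.2 hD)
    (show 0 < p₁ + p₂ by linarith) (show 0 < p₁ - p₂ by linarith) g1' g2' f1 f2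
  rcases abs_cases (p + q) with ⟨h, _⟩ | ⟨h, _⟩ <;> rcases abs_cases (p - q) with ⟨h', _⟩ | ⟨h', _⟩
  · iterate 5 right
    exact Or.inl ⟨by linarith, by linarith⟩
  · iterate 7 right
    exact Or.inl ⟨by linarith, by linarith⟩
  · iterate 8 right
    exact ⟨by linarith, by linarith⟩
  · iterate 6 right
    exact Or.inl ⟨by linarith, by linarith⟩

/-- Proposition 2, case 1d: for J₁₁ > 0, J₁₂ < 0, λ_M = J₁₁ − J₁₂, λ_m = J₁₁ + J₁₂ > 0,
and β̌ ∈ (0,1) solving β̌·artanh(√(1−β̌))/√(1−β̌) = λ_m/λ_M, if β > 2/(β̌λ_M) then f has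
exactly nine critical points: (0,0) (a local minimum), ±(x̃,−x̃) and ±(x̂,x̂) (local
maxima), and four further points ±(x₁*,x₂*), ±(x₂*,x₁*), none of which is a local
maximum point. -/
theorem prop2_case1d (β J11 J12 βch : ℝ) (hJ11 : 0 < J11) (hJ12 : J12 < 0)
    (hlm : 0 < J11 + J12) (hβ0 : 0 < β)
    (hβch : βch ∈ Set.Ioo (0 : ℝ) 1)
    (hβcheq : βch * artanh (Real.sqrt (1 - βch)) / Real.sqrt (1 - βch)
      = (J11 + J12) / (J11 - J12))
    (hβlo : 2 / (βch * (J11 - J12)) < β) :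
    ∃ xt xh x1s x2s : ℝ, xt ∈ Set.Ioo (0 : ℝ) 1 ∧ xh ∈ Set.Ioo (0 : ℝ) 1 ∧
      x1s ∈ Set.Ioo (0 : ℝ) 1 ∧ x2s ∈ Set.Ioo (0 : ℝ) 1 ∧ x1s ≠ x2s ∧
      xt = Real.tanh (β * (J11 - J12) / 2 * xt) ∧
      (∀ y ∈ Set.Ioo (0 : ℝ) 1, y = Real.tanh (β * (J11 - J12) / 2 * y) → y = xt) ∧
      xh = Real.tanh (β * (J11 + J12) / 2 * xh) ∧
      (∀ y ∈ Set.Ioo (0 : ℝ) 1, y = Real.tanh (β * (J11 + J12) / 2 * y) → y = xh) ∧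
      {μ : ℝ × ℝ | IsCritPt β J11 J12 μ}
        = {(0, 0), (xt, -xt), (-xt, xt), (xh, xh), (-xh, -xh),
            (x1s, x2s), (-x1s, -x2s), (x2s, x1s), (-x2s, -x1s)} ∧
      IsLocalMin (fSym β J11 J12) (0, 0) ∧
      IsLocalMax (fSym β J11 J12) (xt, -xt) ∧ IsLocalMax (fSym β J11 J12) (-xt, xt) ∧
      IsLocalMax (fSym β J11 J12) (xh, xh) ∧ IsLocalMax (fSym β J11 J12) (-xh, -xh) ∧
      ¬ IsLocalMax (fSym β J11 J12) (x1s, x2s) ∧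
      ¬ IsLocalMax (fSym β J11 J12) (-x1s, -x2s) ∧
      ¬ IsLocalMax (fSym β J11 J12) (x2s, x1s) ∧
      ¬ IsLocalMax (fSym β J11 J12) (-x2s, -x1s) := by
  rw [fSym_eq]
  simp only [isCritPt_eq β J11 J12]
  obtain ⟨a, ha⟩ : ∃ a, a = β * J11 / 2 := ⟨_, rfl⟩
  obtain ⟨b, hb⟩ : ∃ b, b = -(β * J12 / 2) := ⟨_, rfl⟩
  have hb' : β * J12 / 2 = -b := by rw [hb, neg_neg]
  have hbpos : 0 < b := by rw [hb]; nlinarith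
  have hM : β * (J11 - J12) / 2 = a + b := by rw [ha, hb]; ring
  have hm : β * (J11 + J12) / 2 = a - b := by rw [ha, hb]; ring
  have hmpos : 0 < a - b := by rw [← hm]; positivity
  rw [← ha, hb', hM, hm]
  -- the bifurcation parameter in hyperbolic coordinates
  obtain ⟨hβ1, hβ2⟩ := hβch
  have hs0 : 0 < Real.sqrt (1 - βch) := Real.sqrt_pos.2 (by linarith)
  have hs2 : Real.sqrt (1 - βch) ^ 2 = 1 - βch := Real.sq_sqrt (by linarith)
  have hs1 : Real.sqrt (1 - βch) < 1 := by nlinarith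
  obtain ⟨p₀, hp₀⟩ := exists_eq_tanh (x := Real.sqrt (1 - βch)) ⟨by linarith, hs1⟩
  have hp₀pos : 0 < p₀ := tanh_pos_iff.1 (hp₀ ▸ hs0)
  have hc₀ := Real.cosh_pos p₀
  have hsh₀ := Real.sinh_pos_iff.2 hp₀pos
  have hβc : βch = 1 / Real.cosh p₀ ^ 2 := by
    rw [← one_sub_tanh_sq, ← hp₀, hs2]; ring
  have hMpos : 0 < J11 - J12 := by linarith
  have hMc : Real.cosh p₀ ^ 2 < a + b := by
    rw [← hM]
    rw [hβc, div_lt_iff₀ (by positivity)] at hβlo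
    field_simp at hβlo
    linarith
  have hbif : (a + b) * p₀ = (a - b) * (Real.sinh p₀ * Real.cosh p₀) := by
    rw [hp₀, artanh_tanh_eq, hβc, Real.tanh_eq_sinh_div_cosh] at hβcheq
    field_simp at hβcheq
    rw [← hM, ← hm]
    linear_combination β / 2 * hβcheq
  have hm1 : 1 < a - b := by
    have h1 := sinh_lt_mul_cosh hp₀pos
    have h2 := mul_lt_mul_of_pos_right hMc hp₀pos
    have h3 := mul_lt_mul_of_pos_right h1 hc₀
    have h4 : 0 < Real.sinh p₀ * Real.cosh p₀ := by positivity
    nlinarith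
  -- the critical points
  obtain ⟨pt, hpt, het⟩ := exists_pos_eq_mul_tanh (show 1 < a + b by linarith)
  obtain ⟨ph, hph, heh⟩ := exists_pos_eq_mul_tanh hm1
  have hst := lt_cosh_sq_of_bifurcation hmpos hp₀pos hph hbif hMc heh
  obtain ⟨p₁, p₂, h₂, h₂₁, hs₁, hs₂⟩ := exists_mixed hbpos hm1 hph heh hst
  have hstt : a + b < Real.cosh pt ^ 2 := by
    have h1 := Real.sinh_pos_iff.2 hpt
    rw [← (eq_mul_tanh_iff hpt).1 het, div_lt_iff₀ h1]
    have h2 := Real.self_lt_sinh_iff.2 hpt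
    have h3 := Real.one_le_cosh pt
    have h4 : pt < Real.cosh pt * Real.sinh pt := by nlinarith
    nlinarith
  have hA : ∀ p, 1 / (1 - Real.tanh p ^ 2) = Real.cosh p ^ 2 := fun p => by
    rw [one_sub_tanh_sq, one_div_one_div]
  have hdet : (Real.cosh p₁ ^ 2 - a) * (Real.cosh p₂ ^ 2 - a) < b ^ 2 :=
    have h := tanh_system_iff.1 ⟨hs₁, hs₂⟩
    det_neg_of_rotated h₂ h₂₁ h.1 h.2
  have huniq : ∀ c p, 0 < p → p = c * Real.tanh p →
      ∀ y ∈ Set.Ioo (0 : ℝ) 1, y = Real.tanh (c * y) → y = Real.tanh p := by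
    intro c p hp he y hy hyc
    obtain ⟨r, rfl⟩ := exists_eq_tanh (x := y) ⟨by linarith [hy.1], hy.2⟩
    have : r = c * Real.tanh r := Real.tanh_injective hyc
    rw [eq_of_eq_mul_tanh (tanh_pos_iff.1 hy.1) hp this he]
  have cr : ∀ p q, p = a * Real.tanh p - b * Real.tanh q → q = a * Real.tanh q - b * Real.tanh p →
      IsCritPt 2 a (-b) (Real.tanh p, Real.tanh q) := fun p q h h' => isCritPt_tanh_iff.2 ⟨h, h'⟩
  have c0 : IsCritPt 2 a (-b) (0, 0) := by simpa using cr 0 0 (by simp) (by simp)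
  have ct1 : IsCritPt 2 a (-b) (Real.tanh pt, -Real.tanh pt) := by
    rw [← Real.tanh_neg]; apply cr <;> rw [Real.tanh_neg] <;> linarith
  have ct2 : IsCritPt 2 a (-b) (-Real.tanh pt, Real.tanh pt) := by
    rw [← Real.tanh_neg]; apply cr <;> rw [Real.tanh_neg] <;> linarith
  have ch1 : IsCritPt 2 a (-b) (Real.tanh ph, Real.tanh ph) := by apply cr <;> linarith
  have ch2 : IsCritPt 2 a (-b) (-Real.tanh ph, -Real.tanh ph) := by
    rw [← Real.tanh_neg]; apply cr <;> rw [Real.tanh_neg] <;> linarith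
  have cs1 := cr p₁ p₂ hs₁ hs₂
  have cs3 := cr p₂ p₁ hs₂ hs₁
  have cs2 : IsCritPt 2 a (-b) (-Real.tanh p₁, -Real.tanh p₂) := by
    rw [← Real.tanh_neg, ← Real.tanh_neg]
    apply cr <;> rw [Real.tanh_neg, Real.tanh_neg] <;> linarith
  have cs4 : IsCritPt 2 a (-b) (-Real.tanh p₂, -Real.tanh p₁) := by
    rw [← Real.tanh_neg, ← Real.tanh_neg]
    apply cr <;> rw [Real.tanh_neg, Real.tanh_neg] <;> linarith
  refine ⟨Real.tanh pt, Real.tanh ph, Real.tanh p₁, Real.tanh p₂,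
    ⟨tanh_pos_iff.2 hpt, Real.tanh_lt_one _⟩, ⟨tanh_pos_iff.2 hph, Real.tanh_lt_one _⟩,
    ⟨tanh_pos_iff.2 (h₂.trans h₂₁), Real.tanh_lt_one _⟩, ⟨tanh_pos_iff.2 h₂, Real.tanh_lt_one _⟩,
    (tanh_lt_tanh_iff.2 h₂₁).ne', by rw [← het], huniq _ _ hpt het, by rw [← heh],
    huniq _ _ hph heh, ?_, isLocalMin_fSym_zero hbpos hm1, ?_, ?_, ?_, ?_, ?_, ?_, ?_, ?_⟩
  · ext ⟨x, y⟩
    simp only [Set.mem_ofPred_eq, Set.mem_insert_iff, Set.mem_singleton_iff, Prod.mk.injEq]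
    constructor
    · intro h
      obtain ⟨p, rfl⟩ := exists_eq_tanh h.1
      obtain ⟨q, rfl⟩ := exists_eq_tanh h.2.1
      obtain ⟨e1, e2⟩ := isCritPt_tanh_iff.1 h
      have := tanh_system_cases hbpos hmpos hpt het hph heh h₂ h₂₁ hs₁ hs₂ e1 e2
      simp only [← Real.tanh_neg, Real.tanh_injective.eq_iff]
      rw [← Real.tanh_zero]
      simpa only [Real.tanh_injective.eq_iff] using this
    · rintro (⟨rfl, rfl⟩ | ⟨rfl, rfl⟩ | ⟨rfl, rfl⟩ | ⟨rfl, rfl⟩ | ⟨rfl, rfl⟩ | ⟨rfl, rfl⟩ |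
        ⟨rfl, rfl⟩ | ⟨rfl, rfl⟩ | ⟨rfl, rfl⟩) <;> assumption
  · apply isLocalMax_fSym hbpos ct1 <;> simpa only [neg_sq, hA] using hstt
  · apply isLocalMax_fSym hbpos ct2 <;> simpa only [neg_sq, hA] using hstt
  · apply isLocalMax_fSym hbpos ch1 <;> simpa only [hA] using hst
  · apply isLocalMax_fSym hbpos ch2 <;> simpa only [neg_sq, hA] using hst
  · apply not_isLocalMax_of_det_neg hbpos cs1; simpa only [hA] using hdet
  · apply not_isLocalMax_of_det_neg hbpos cs2; simpa only [neg_sq, hA] using hdet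
  · apply not_isLocalMax_of_det_neg hbpos cs3; rw [hA, hA, mul_comm]; exact hdet
  · apply not_isLocalMax_of_det_neg hbpos cs4; rw [neg_sq, neg_sq, hA, hA, mul_comm]; exact hdet
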